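/- Assume 1 ≤ j < k ≤ i. Then P₁ = Σ_{d∈(ℤ/p^iℤ)^×} (d/p)^i · λ(p^j βd + p^k b d⁻¹) equals: −p^{i−1} if j = i−1 and i is even; (βr/p)·c_p·p^{i−1}·√p if j = i−1 and i is odd; and 0 if j < i−1. (§4, case (ii).) -/

import Mathlib

noncomputable section
open Matrix Complex

/-- The additive character `x ↦ ζ_N^{r·x} = exp(2πi·r·x/N)` of `ZMod N`. -/
def aChar (N : ℕ) (r : ℤ) (x : ZMod N) : ℂ :=
  Complex.exp (2 * Real.pi * Complex.I * (r : ℂ) * (x.val : ℂ) / (N : ℂ))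

/-- The Legendre symbol `(x/p)` of an element `x : ZMod N` (via its residue mod `p`). -/
def legC (p : ℕ) [Fact p.Prime] {N : ℕ} (x : ZMod N) : ℂ :=
  (legendreSym p (x.val : ℤ) : ℂ)

/-- `c_p = (−1/p)^{1/2}`: `1` if `p ≡ 1 (mod 4)` and `√−1` if `p ≡ 3 (mod 4)`. -/
def cP (p : ℕ) : ℂ := if p % 4 = 1 then 1 else Complex.I

/-- `P₁ = Σ_{d ∈ (ℤ/p^i)^×} (d/p)^i · λ(p^j βd + p^k b d⁻¹)` with `λ = aChar (p^i) r`. -/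
def P1 (p i : ℕ) [Fact p.Prime] (r : ℤ) (β b : (ZMod (p ^ i))ˣ) (j k : ℕ) : ℂ :=
  ∑ d : (ZMod (p ^ i))ˣ,
    legC p (d : ZMod (p ^ i)) ^ i *
      aChar (p ^ i) r ((p : ZMod (p ^ i)) ^ j * (β : ZMod (p ^ i)) * (d : ZMod (p ^ i)) +
        (p : ZMod (p ^ i)) ^ k * (b : ZMod (p ^ i)) * ((d⁻¹ : (ZMod (p ^ i))ˣ) : ZMod (p ^ i)))

open Polynomial in
/-- Iterating `f ↦ X f'` on `(X - 1) ^ (p - 1)` over `ZMod p`: the leading term at `X = 1`. -/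
lemma iterate_X_mul_derivative_X_sub_one_pow (p : ℕ) (n : ℕ) :
    ∀ M : ℕ, M + n + 1 = p → ∃ q : (ZMod p)[X],
      (fun f : (ZMod p)[X] => X * derivative f)^[n] ((X - 1) ^ (p - 1)) =
        (X - 1) ^ M * (C ((-1) ^ n * (n.factorial : ZMod p)) + (X - 1) * q) := by
  induction n with
  | zero =>
    intro M hM
    refine ⟨0, ?_⟩
    obtain rfl : M = p - 1 := by omega
    simp
  | succ n ih =>
    intro M hM
    obtain ⟨q, hq⟩ := ih (M + 1) (by omega)
    have hc : (M : (ZMod p)[X]) = -(n + 2) := by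
      have h : ((M + (n + 1) + 1 : ℕ) : ZMod p) = 0 := by rw [hM]; simp
      have h2 := congrArg (C : ZMod p → (ZMod p)[X]) h
      simp only [Nat.cast_add, Nat.cast_one, map_add, map_one, map_zero, map_natCast] at h2
      linear_combination h2
    rw [Function.iterate_succ_apply', hq]
    set c : ZMod p := (-1) ^ n * (n.factorial : ZMod p) with hcdef
    have hc' : C ((-1) ^ (n + 1) * ((n + 1).factorial : ZMod p)) =
        -((n : (ZMod p)[X]) + 1) * C c := by
      rw [hcdef, Nat.factorial_succ]
      simp only [map_mul, map_natCast, map_pow, map_neg, map_one, Nat.cast_mul, Nat.cast_add,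
        Nat.cast_one, map_add]
      ring
    refine ⟨((M : (ZMod p)[X]) + 1) * (C c + (X - 1) * q) + ((M : (ZMod p)[X]) + 1) * q +
      X * derivative (C c + (X - 1) * q), ?_⟩
    rw [hc']
    simp only [derivative_mul, derivative_add, derivative_C,
      derivative_sub, derivative_X, derivative_one, derivative_pow]
    simp only [map_natCast, map_add, map_one, Nat.cast_add, Nat.cast_one, Nat.add_sub_cancel, hc]
    ring

open Polynomial in
lemma iterate_X_mul_derivative_sum_X_pow {R : Type*} [CommRing R] (N n : ℕ) :
    (fun f : R[X] => X * derivative f)^[n] (∑ j ∈ Finset.range N, X ^ j) =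
      ∑ j ∈ Finset.range N, C ((j : R) ^ n) * X ^ j := by
  induction n with
  | zero => simp
  | succ n ih =>
    rw [Function.iterate_succ_apply', ih]
    simp only [derivative_sum, Finset.mul_sum]
    refine Finset.sum_congr rfl fun j _ => ?_
    rw [derivative_C_mul, derivative_X_pow]
    rcases j with _ | j
    · simp
    · simp only [map_pow, map_natCast, Nat.add_sub_cancel]
      ring

open Polynomial in
lemma cyclotomic_self_zmod (p : ℕ) [Fact p.Prime] :
    cyclotomic p (ZMod p) = (X - 1) ^ (p - 1) := by
  have h := cyclotomic_mul_prime_eq_pow_of_not_dvd (ZMod p) (p := p) (n := 1)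
    (Fact.out : p.Prime).not_dvd_one
  rwa [one_mul, cyclotomic_one] at h

open Polynomial in
/-- Leading term at `X = 1` of the product of the `X ^ (k a) * (X ^ k - 1)` for `1 ≤ k ≤ m`. -/
lemma prod_X_pow_mul_X_pow_sub_one {R : Type*} [CommRing R] (a m : ℕ) :
    ∃ q : R[X], ∏ k ∈ Finset.range m, ((X : R[X]) ^ ((k + 1) * a) * (X ^ (k + 1) - 1)) =
      (X - 1) ^ m * (C (m.factorial : R) + (X - 1) * q) := by
  induction m with
  | zero => exact ⟨0, by simp⟩
  | succ m ih =>
    obtain ⟨q, hq⟩ := ih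
    have key : ∃ s : R[X], (X : R[X]) ^ ((m + 1) * a) * ∑ i ∈ Finset.range (m + 1), X ^ i =
        C ((m + 1 : ℕ) : R) + (X - 1) * s := by
      have : (X - C 1 : R[X]) ∣ (X : R[X]) ^ ((m + 1) * a) * (∑ i ∈ Finset.range (m + 1), X ^ i)
          - C ((m + 1 : ℕ) : R) := by
        rw [dvd_iff_isRoot]
        simp [IsRoot, eval_finsetSum]
      obtain ⟨s, hs⟩ := this
      refine ⟨s, ?_⟩
      rw [C_1] at hs
      linear_combination hs
    obtain ⟨s, hs⟩ := key
    refine ⟨q * C ((m + 1 : ℕ) : R) + C (m.factorial : R) * s + (X - 1) * q * s, ?_⟩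
    rw [Finset.prod_range_succ, hq, ← geom_sum_mul, ← mul_assoc (X ^ _), hs, Nat.factorial_succ,
      Nat.cast_mul, map_mul]
    ring

open Polynomial in
/-- If the quadratic Gauss sum is `ε` times the product `∏ ζ ^ (k m) (ζ ^ k - 1)` over
`1 ≤ k ≤ m = (p - 1) / 2`, then `ε ≡ (-1) ^ m` modulo `p`. -/
lemma sign_eq_of_sum_legendreSym_eq (p m : ℕ) [Fact p.Prime] (hm : p = 2 * m + 1) (ζ : ℂ)
    (hζ : IsPrimitiveRoot ζ p) (ε : ℤ)
    (h : ∑ j ∈ Finset.range p, (legendreSym p j : ℂ) * ζ ^ j =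
      ε * ∏ k ∈ Finset.range m, (ζ ^ ((k + 1) * m) * (ζ ^ (k + 1) - 1))) :
    (ε : ZMod p) = (-1) ^ m := by
  have hp : p.Prime := Fact.out
  have hm0 : 0 < m := by
    have := hp.two_le
    omega
  set F : ℤ[X] := ∑ j ∈ Finset.range p, C (legendreSym p j) * X ^ j -
    C ε * ∏ k ∈ Finset.range m, (X ^ ((k + 1) * m) * (X ^ (k + 1) - 1)) with hF
  have hdvd : cyclotomic p ℤ ∣ F := by
    rw [cyclotomic_eq_minpoly hζ hp.pos]
    refine minpoly.isIntegrallyClosed_dvd (hζ.isIntegral hp.pos) ?_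
    simp [hF, map_prod, h]
  have hdvd2 := map_dvd (mapRingHom (Int.castRingHom (ZMod p))) hdvd
  rw [coe_mapRingHom, map_cyclotomic, cyclotomic_self_zmod] at hdvd2
  obtain ⟨G, hG⟩ := hdvd2
  obtain ⟨q, hq⟩ := prod_X_pow_mul_X_pow_sub_one (R := ZMod p) m m
  obtain ⟨s, hs⟩ := iterate_X_mul_derivative_X_sub_one_pow p m m (by omega)
  rw [← cyclotomic_self_zmod, cyclotomic_prime, iterate_X_mul_derivative_sum_X_pow] at hs
  have hp2 : p / 2 = m := by omega
  have hF' : F.map (Int.castRingHom (ZMod p)) =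
      (X - 1) ^ m * (C ((-1) ^ m * (m.factorial : ZMod p)) + (X - 1) * s) -
        C (ε : ZMod p) * ((X - 1) ^ m * (C (m.factorial : ZMod p) + (X - 1) * q)) := by
    rw [← hs, ← hq, hF]
    have hleg (j : ℕ) : ((legendreSym p j : ℤ) : (ZMod p)[X]) = (j : (ZMod p)[X]) ^ m := by
      have := congrArg (C : ZMod p → (ZMod p)[X]) (legendreSym.eq_pow p j)
      simpa [hp2] using this
    simp [Polynomial.map_sum, Polynomial.map_prod, hleg]
  rw [hF', show p - 1 = m + m by omega, pow_add] at hG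
  have hX : ((X : (ZMod p)[X]) - 1) ^ m ≠ 0 := pow_ne_zero _ (by
    simpa using X_sub_C_ne_zero (1 : ZMod p))
  have hG2 : C ((-1) ^ m * (m.factorial : ZMod p)) + (X - 1) * s -
      C (ε : ZMod p) * (C (m.factorial : ZMod p) + (X - 1) * q) = (X - 1) ^ m * G := by
    apply mul_left_cancel₀ hX
    linear_combination hG
  have h1 := congrArg (eval 1) hG2
  simp [hm0.ne'] at h1
  have hfac : (m.factorial : ZMod p) ≠ 0 := by
    rw [Ne, ZMod.natCast_eq_zero_iff, hp.dvd_factorial]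
    omega
  apply mul_right_cancel₀ hfac
  linear_combination -h1

lemma two_mul_sin_prod_sq (m : ℕ) :
    (∏ k ∈ Finset.range m, (2 * Real.sin (Real.pi * (k + 1) / (2 * m + 1)))) ^ 2 = 2 * m + 1 := by
  have hpos : (0 : ℝ) < 2 * m + 1 := by positivity
  have hζ := Complex.isPrimitiveRoot_exp (2 * m + 1) (by omega)
  have h := congrArg norm hζ.prod_one_sub_pow_eq_order
  rw [norm_prod] at h
  have hnorm (k : ℕ) (hk : k < 2 * m) :
      ‖1 - Complex.exp (2 * Real.pi * I / ((2 * m + 1 : ℕ) : ℂ)) ^ (k + 1)‖ =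
        2 * Real.sin (Real.pi * (k + 1) / (2 * m + 1)) := by
    have hlt : (k : ℝ) + 1 < 2 * m + 1 := by exact_mod_cast Nat.succ_lt_succ hk
    have h0 : 0 ≤ Real.sin (Real.pi * (k + 1) / (2 * m + 1)) := by
      apply Real.sin_nonneg_of_nonneg_of_le_pi (by positivity)
      rw [div_le_iff₀ hpos]
      exact mul_le_mul_of_nonneg_left hlt.le Real.pi_pos.le
    rw [← Complex.exp_nat_mul, norm_sub_rev]
    have : ((k + 1 : ℕ) : ℂ) * (2 * Real.pi * I / ((2 * m + 1 : ℕ) : ℂ)) =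
        I * ((2 * (Real.pi * (k + 1) / (2 * m + 1)) : ℝ) : ℂ) := by
      push_cast
      ring
    rw [this, Complex.norm_exp_I_mul_ofReal_sub_one]
    rw [mul_div_cancel_left₀ _ (two_ne_zero), Real.norm_eq_abs, abs_of_nonneg (by positivity)]
  rw [Finset.prod_congr rfl fun k hk => hnorm k (Finset.mem_range.1 hk), two_mul m,
    Finset.prod_range_add, ← Finset.prod_range_reflect (fun x => 2 * Real.sin
      (Real.pi * (((m + x : ℕ) : ℝ) + 1) / (2 * m + 1)))] at h
  have hrefl : ∏ j ∈ Finset.range m, (2 * Real.sin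
      (Real.pi * (((m + (m - 1 - j) : ℕ) : ℝ) + 1) / (2 * m + 1))) =
      ∏ k ∈ Finset.range m, (2 * Real.sin (Real.pi * (k + 1) / (2 * m + 1))) := by
    refine Finset.prod_congr rfl fun j hj => ?_
    have hj' := Finset.mem_range.1 hj
    have : ((m + (m - 1 - j) : ℕ) : ℝ) = 2 * m - 1 - j := by
      rw [show m + (m - 1 - j) = 2 * m - (1 + j) by omega, Nat.cast_sub (by omega)]
      push_cast
      ring
    rw [this, ← Real.sin_pi_sub]
    congr 2
    field_simp
    ring
  rw [hrefl, ← sq] at h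
  rw [h, ← Nat.cast_succ, Complex.norm_natCast]
  push_cast
  ring

lemma two_mul_sin_prod (m : ℕ) :
    ∏ k ∈ Finset.range m, (2 * Real.sin (Real.pi * (k + 1) / (2 * m + 1))) =
      Real.sqrt (2 * m + 1) := by
  refine (Real.sqrt_eq_iff_eq_sq (by positivity) ?_).2 (two_mul_sin_prod_sq m).symm |>.symm
  refine Finset.prod_nonneg fun k hk => mul_nonneg (zero_le_two (α := ℝ)) ?_
  have hlt : (k : ℝ) + 1 ≤ 2 * m + 1 := by
    have := Finset.mem_range.1 hk
    exact_mod_cast (by omega : k + 1 ≤ 2 * m + 1)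
  apply Real.sin_nonneg_of_nonneg_of_le_pi (by positivity)
  rw [div_le_iff₀ (by positivity)]
  exact mul_le_mul_of_nonneg_left hlt Real.pi_pos.le

lemma prod_neg_one_pow_mul_I (m : ℕ) :
    ∏ k ∈ Finset.range m, ((-1) ^ k * I) = if Even m then 1 else I := by
  induction m with
  | zero => simp
  | succ m ih =>
    rw [Finset.prod_range_succ, ih]
    rcases Nat.even_or_odd m with h | h
    · simp [h, Nat.even_add_one, h.neg_one_pow]
    · simp [Nat.not_even_iff_odd.2 h, Nat.even_add_one, h.neg_one_pow]

lemma neg_one_pow_mul_prod_eq (p m : ℕ) (hm : p = 2 * m + 1) :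
    (-1) ^ m * ∏ k ∈ Finset.range m,
      (Complex.exp (2 * Real.pi * I / p) ^ ((k + 1) * m) *
        (Complex.exp (2 * Real.pi * I / p) ^ (k + 1) - 1)) = cP p * (Real.sqrt p : ℂ) := by
  have hc : cP p = ∏ k ∈ Finset.range m, ((-1) ^ k * I) := by
    rw [prod_neg_one_pow_mul_I, cP]
    have : p % 4 = 1 ↔ Even m := by
      rw [Nat.even_iff]
      omega
    simp only [this]
  have hs : ((Real.sqrt p : ℝ) : ℂ) = ∏ k ∈ Finset.range m,
      ((2 * Real.sin (Real.pi * (k + 1) / (2 * m + 1)) : ℝ) : ℂ) := by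
    rw [← Complex.ofReal_prod, two_mul_sin_prod, hm]
    push_cast
    rfl
  have h1 : ((-1 : ℂ)) ^ m = ∏ k ∈ Finset.range m, (-1) := by simp
  rw [hc, hs, h1, ← Finset.prod_mul_distrib, ← Finset.prod_mul_distrib]
  refine Finset.prod_congr rfl fun k _ => ?_
  have hp0 : (2 * (m : ℂ) + 1) ≠ 0 := by
    exact_mod_cast (by omega : 2 * m + 1 ≠ 0)
  set x : ℂ := Real.pi * (k + 1) / (2 * m + 1) with hx
  have e1 : Complex.exp (2 * Real.pi * I / p) ^ ((k + 1) * m) =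
      (-1) ^ (k + 1) * Complex.exp (-(x * I)) := by
    rw [← Complex.exp_nat_mul, ← Complex.exp_pi_mul_I, ← Complex.exp_nat_mul, ← Complex.exp_add, hm]
    congr 1
    rw [hx]
    push_cast
    linear_combination (Real.pi * I * (k + 1)) * mul_inv_cancel₀ hp0
  have e2 : Complex.exp (2 * Real.pi * I / p) ^ (k + 1) =
      Complex.exp (x * I) * Complex.exp (x * I) := by
    rw [← Complex.exp_nat_mul, ← Complex.exp_add, hm]
    congr 1
    rw [hx]
    push_cast
    ring
  have e3 : Complex.exp (-(x * I)) * Complex.exp (x * I) = 1 := by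
    rw [← Complex.exp_add]
    simp
  have e4 : ((2 * Real.sin (Real.pi * (k + 1) / (2 * m + 1)) : ℝ) : ℂ) * I =
      Complex.exp (x * I) - Complex.exp (-(x * I)) := by
    have h2 := Complex.two_sin x
    have : ((Real.sin (Real.pi * (k + 1) / (2 * m + 1)) : ℝ) : ℂ) = Complex.sin x := by
      rw [hx]
      push_cast
      rfl
    rw [Complex.ofReal_mul, this, Complex.ofReal_ofNat, h2, neg_mul]
    linear_combination (Complex.exp (-(x * I)) - Complex.exp (x * I)) * Complex.I_sq
  rw [e1, e2]
  calc _ = (-1) ^ k * ((Complex.exp (-(x * I)) * Complex.exp (x * I)) * Complex.exp (x * I) -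
        Complex.exp (-(x * I))) := by ring
    _ = _ := by rw [e3, one_mul, ← e4]; ring

/-- The quadratic character of `ZMod p` with complex values. -/
abbrev quadCharC (p : ℕ) [Fact p.Prime] : MulChar (ZMod p) ℂ :=
  (quadraticChar (ZMod p)).ringHomComp (Int.castRingHom ℂ)

lemma sum_zmod_eq_sum_range {M : Type*} [AddCommMonoid M] (p : ℕ) [NeZero p] (f : ZMod p → M) :
    ∑ a : ZMod p, f a = ∑ j ∈ Finset.range p, f j := by
  refine Finset.sum_nbij' (fun a => a.val) (fun j => (j : ZMod p)) ?_ ?_ ?_ ?_ ?_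
  · intro a _
    exact Finset.mem_range.2 a.val_lt
  · simp
  · simp
  · intro j hj
    exact ZMod.val_cast_of_lt (Finset.mem_range.1 hj)
  · simp

/-- Gauss's evaluation of the quadratic Gauss sum, including its sign. -/
theorem gaussSum_quadCharC (p : ℕ) [Fact p.Prime] (hp : Odd p) :
    gaussSum (quadCharC p) (ZMod.stdAddChar (N := p)) = cP p * (Real.sqrt p : ℂ) := by
  obtain ⟨m, hm⟩ := hp
  have hpp : p.Prime := Fact.out
  have hp2 : p ≠ 2 := by omega
  have hchar : ringChar (ZMod p) ≠ 2 := by rwa [ZMod.ringChar_zmod_n]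
  have hP := neg_one_pow_mul_prod_eq p m hm
  set ζ := Complex.exp (2 * Real.pi * I / p) with hζ
  set P := ∏ k ∈ Finset.range m, (ζ ^ ((k + 1) * m) * (ζ ^ (k + 1) - 1)) with hPdef
  have hprim : IsPrimitiveRoot ζ p := Complex.isPrimitiveRoot_exp p hpp.ne_zero
  have hsum : gaussSum (quadCharC p) (ZMod.stdAddChar (N := p)) =
      ∑ j ∈ Finset.range p, (legendreSym p j : ℂ) * ζ ^ j := by
    rw [gaussSum, sum_zmod_eq_sum_range]
    refine Finset.sum_congr rfl fun j _ => ?_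
    have h := ZMod.stdAddChar_coe (N := p) (j : ℤ)
    rw [Int.cast_natCast] at h
    rw [h, hζ, ← Complex.exp_nat_mul]
    congr 1
    · simp [legendreSym]
    · congr 1
      push_cast
      ring
  have hsq : gaussSum (quadCharC p) (ZMod.stdAddChar (N := p)) ^ 2 =
      (cP p * (Real.sqrt p : ℂ)) ^ 2 := by
    have hne : quadCharC p ≠ 1 := by
      rw [Ne, MulChar.ringHomComp_eq_one_iff Int.cast_injective]
      exact quadraticChar_ne_one hchar
    rw [gaussSum_sq hne ((quadraticChar_isQuadratic (ZMod p)).comp _)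
      (ZMod.isPrimitive_stdAddChar p), mul_pow, ← Complex.ofReal_pow,
      Real.sq_sqrt (Nat.cast_nonneg p), ZMod.card, MulChar.ringHomComp_apply,
      quadraticChar_neg_one hchar, ZMod.card, ZMod.χ₄_nat_eq_if_mod_four, cP]
    have : p % 4 = 1 ∨ p % 4 = 3 := by omega
    rcases this with h | h <;> simp [h, show p % 2 = 1 by omega]
  rcases sq_eq_sq_iff_eq_or_eq_neg.1 hsq with h | h
  · exact h
  · exfalso
    have hε := sign_eq_of_sum_legendreSym_eq p m hm ζ hprim (-(-1) ^ m) (by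
      rw [← hsum, h, ← hP]
      push_cast
      ring)
    push_cast at hε
    have h2 : (2 : ZMod p) = 0 := by
      rcases neg_one_pow_eq_or (ZMod p) m with h' | h' <;> rw [h'] at hε
      · linear_combination -hε
      · linear_combination hε
    have : ((2 : ℕ) : ZMod p) = 0 := by exact_mod_cast h2
    rw [ZMod.natCast_eq_zero_iff] at this
    exact hp2 ((Nat.prime_dvd_prime_iff_eq hpp Nat.prime_two).1 this)

lemma aChar_eq_stdAddChar (N : ℕ) [NeZero N] (r : ℤ) (x : ZMod N) :
    aChar N r x = ZMod.stdAddChar ((r : ZMod N) * x) := by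
  have h := ZMod.stdAddChar_coe (N := N) (r * (x.val : ℤ))
  rw [Int.cast_mul, Int.cast_natCast, ZMod.natCast_zmod_val] at h
  rw [h, aChar]
  congr 1
  push_cast
  ring

lemma stdAddChar_prime_pow_mul (p n : ℕ) [Fact p.Prime] (x : ZMod (p ^ (n + 1))) :
    ZMod.stdAddChar ((p : ZMod (p ^ (n + 1))) ^ n * x) =
      ZMod.stdAddChar (ZMod.castHom (dvd_pow_self p n.succ_ne_zero) (ZMod p) x) := by
  have hp : (p : ℂ) ≠ 0 := Nat.cast_ne_zero.2 (Fact.out : p.Prime).ne_zero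
  obtain ⟨z, rfl⟩ := ZMod.intCast_surjective x
  have h := ZMod.stdAddChar_coe (N := p ^ (n + 1)) ((p : ℤ) ^ n * z)
  push_cast at h
  rw [h, map_intCast, ZMod.stdAddChar_coe]
  congr 1
  field_simp
  ring

lemma legC_eq_quadCharC (p N : ℕ) [Fact p.Prime] [NeZero N] (h : p ∣ N) (x : ZMod N) :
    legC p x = quadCharC p (ZMod.castHom h (ZMod p) x) := by
  simp [legC, legendreSym]

lemma sum_comp_surjective_hom {G H M : Type*} [Group G] [Group H] [Fintype G] [Fintype H]
    [CommRing M] (f : G →* H) (hf : Function.Surjective f) (c : ℕ)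
    (hc : Fintype.card G = c * Fintype.card H) (g : H → M) :
    ∑ x, g (f x) = c * ∑ y, g y := by
  classical
  have hfib (y : H) : (Finset.univ.filter fun x => f x = y).card =
      (Finset.univ.filter fun x => f x = 1).card :=
    MonoidHom.card_fiber_eq_of_mem_range f (hf y) (hf 1)
  have hcard : (Finset.univ.filter fun x => f x = 1).card = c := by
    have h := Finset.card_eq_sum_card_fiberwise (f := f) (s := Finset.univ) (t := Finset.univ)
      (fun _ _ => Finset.mem_coe.2 (Finset.mem_univ _))
    rw [Finset.sum_congr rfl fun y _ => hfib y, Finset.sum_const, smul_eq_mul, Finset.card_univ,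
      Finset.card_univ, hc, mul_comm] at h
    exact (Nat.eq_of_mul_eq_mul_left Fintype.card_pos h).symm
  rw [← Finset.sum_fiberwise Finset.univ f, Finset.mul_sum]
  refine Finset.sum_congr rfl fun y _ => ?_
  rw [Finset.sum_congr rfl (g := fun _ => g y) fun x hx => by rw [(Finset.mem_filter.1 hx).2],
    Finset.sum_const, hfib, hcard, nsmul_eq_mul]

lemma sum_units_prime_pow (p n : ℕ) [Fact p.Prime] (g : (ZMod p)ˣ → ℂ) :
    ∑ d : (ZMod (p ^ (n + 1)))ˣ, g (ZMod.unitsMap (dvd_pow_self p n.succ_ne_zero) d) =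
      (p : ℂ) ^ n * ∑ u, g u := by
  rw [sum_comp_surjective_hom _ (ZMod.unitsMap_surjective _) (p ^ n), Nat.cast_pow]
  rw [ZMod.card_units_eq_totient, ZMod.card_units_eq_totient,
    Nat.totient_prime_pow_succ Fact.out, Nat.totient_prime Fact.out]

lemma gaussSum_eq_sum_units {R R' : Type*} [CommRing R] [Fintype R] [DecidableEq R] [CommRing R']
    (χ : MulChar R R') (ψ : AddChar R R') : gaussSum χ ψ = ∑ u : Rˣ, χ u * ψ u := by
  symm
  refine Finset.sum_of_injOn (fun u : Rˣ => (u : R)) (Units.val_injective.injOn) (by simp) ?_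
    (by simp)
  intro a _ ha
  rw [χ.map_nonunit, zero_mul]
  rintro ⟨u, rfl⟩
  exact ha ⟨u, by simp, rfl⟩

lemma P1_eq_sum (p n : ℕ) [Fact p.Prime] (r : ℤ) (β b : (ZMod (p ^ (n + 1)))ˣ) :
    P1 p (n + 1) r β b n (n + 1) = (p : ℂ) ^ n * ∑ u : (ZMod p)ˣ, quadCharC p u ^ (n + 1) *
      ZMod.stdAddChar
        (((r : ZMod p) * ZMod.castHom (dvd_pow_self p n.succ_ne_zero) (ZMod p) β) * (u : ZMod p)) := by
  rw [← sum_units_prime_pow, P1]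
  refine Finset.sum_congr rfl fun d _ => ?_
  have h0 : (p : ZMod (p ^ (n + 1))) ^ (n + 1) = 0 := by
    rw [← Nat.cast_pow, ZMod.natCast_self]
  rw [legC_eq_quadCharC p _ (dvd_pow_self p n.succ_ne_zero), aChar_eq_stdAddChar, h0, zero_mul,
    zero_mul, add_zero, ← mul_assoc, ← mul_assoc, mul_comm (r : ZMod (p ^ (n + 1))),
    mul_assoc, mul_assoc, stdAddChar_prime_pow_mul]
  simp only [map_mul, map_intCast, mul_assoc]
  rfl

lemma P1_eq_zero (p j e k : ℕ) [Fact p.Prime] (he : 1 ≤ e) (hjk : j < k)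
    (r : ℤ) (hpr : ¬ ((p : ℤ) ∣ r)) (β b : (ZMod (p ^ (j + e + 1)))ˣ) :
    P1 p (j + e + 1) r β b j k = 0 := by
  have hp : p.Prime := Fact.out
  have hpN : p ∣ p ^ (j + e + 1) := dvd_pow_self p (j + e).succ_ne_zero
  set π := ZMod.castHom hpN (ZMod p) with hπ
  have hr : (r : ZMod p) ≠ 0 := by rwa [Ne, ZMod.intCast_zmod_eq_zero_iff_dvd]
  have h0 (l : ℕ) : (p : ZMod (p ^ (j + e + 1))) ^ (j + e + 1 + l) = 0 := by
    rw [pow_add _ (j + e + 1), ← Nat.cast_pow, ZMod.natCast_self, zero_mul]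
  set F : (ZMod (p ^ (j + e + 1)))ˣ → ℂ := fun d =>
    legC p (d : ZMod (p ^ (j + e + 1))) ^ (j + e + 1) *
      aChar (p ^ (j + e + 1)) r (p ^ j * β * d + p ^ k * b * ↑d⁻¹) with hF
  have hP : P1 p (j + e + 1) r β b j k = ∑ d, F d := rfl
  have hshift (t : ZMod (p ^ (j + e + 1))) : ∑ d, F d =
      ∑ d, F d * ZMod.stdAddChar (π t * ((r : ZMod p) * π β * π d)) := by
    have hnil : IsNilpotent ((p : ZMod (p ^ (j + e + 1))) ^ e * t) := by
      refine ⟨j + e + 1, ?_⟩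
      obtain ⟨l, hl⟩ := Nat.exists_eq_add_of_le (Nat.le_mul_of_pos_left (j + e + 1) he)
      rw [mul_pow, ← pow_mul, hl, h0, zero_mul]
    obtain ⟨u, hu⟩ := hnil.isUnit_one_add
    have hpu : (p : ZMod (p ^ (j + e + 1))) ^ k * ↑u⁻¹ = p ^ k := by
      rw [Units.mul_inv_eq_iff_eq_mul, hu, mul_add, mul_one, ← mul_assoc, ← pow_add]
      obtain ⟨l, rfl⟩ := Nat.exists_eq_add_of_lt hjk
      rw [show j + l + 1 + e = j + e + 1 + l by ring, h0, zero_mul, add_zero]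
    have hπu : π u = 1 := by
      rw [hu, map_add, map_mul, map_pow, map_natCast, ZMod.natCast_self, zero_pow (by omega)]
      simp
    rw [← Equiv.sum_comp (Equiv.mulRight u) F]
    refine Finset.sum_congr rfl fun d _ => ?_
    simp only [hF, Equiv.coe_mulRight]
    rw [legC_eq_quadCharC p _ hpN, legC_eq_quadCharC p _ hpN, ← hπ, Units.val_mul, map_mul, hπu,
      mul_one, aChar_eq_stdAddChar, aChar_eq_stdAddChar,
      mul_assoc (quadCharC p (π d) ^ (j + e + 1))]
    congr 1
    have h1 : π t * ((r : ZMod p) * π β * π d) =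
        π ((r : ZMod (p ^ (j + e + 1))) * (β * d * t)) := by
      simp only [map_mul, map_intCast]
      ring
    rw [h1, hπ, ← stdAddChar_prime_pow_mul p (j + e), ← AddChar.map_add_eq_mul]
    congr 1
    rw [_root_.mul_inv_rev, Units.val_mul, hu]
    linear_combination (r * b * ((d⁻¹ : (ZMod (p ^ (j + e + 1)))ˣ) : ZMod (p ^ (j + e + 1)))) * hpu
  have hsum : (p : ℂ) * ∑ d, F d = 0 := by
    calc (p : ℂ) * ∑ d, F d = ∑ t : ZMod p, ∑ d, F d := by simp
      _ = ∑ t : ZMod p, ∑ d, F d * ZMod.stdAddChar (t * ((r : ZMod p) * π β * π d)) := by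
        refine Finset.sum_congr rfl fun t _ => ?_
        obtain ⟨s, rfl⟩ := ZMod.castHom_surjective hpN t
        exact hshift s
      _ = ∑ d, F d * ∑ t : ZMod p, ZMod.stdAddChar (t * ((r : ZMod p) * π β * π d)) := by
        rw [Finset.sum_comm]
        simp only [Finset.mul_sum]
      _ = 0 := by
        refine Finset.sum_eq_zero fun d _ => ?_
        rw [AddChar.sum_mulShift _ (ZMod.isPrimitive_stdAddChar p), if_neg, Nat.cast_zero, mul_zero]
        exact mul_ne_zero (mul_ne_zero hr (β.isUnit.map π).ne_zero) (d.isUnit.map π).ne_zero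
  rw [hP]
  exact (mul_eq_zero.1 hsum).resolve_left (Nat.cast_ne_zero.2 hp.ne_zero)

/-- §4, case (ii): for `1 ≤ j < k ≤ i`, the sum `P₁ = Σ_d (d/p)^i λ(p^j βd + p^k b d⁻¹)`
equals `−p^{i−1}` if `j = i−1` and `i` is even, `(βr/p)·c_p·p^{i−1}·√p` if `j = i−1`
and `i` is odd, and `0` if `j < i−1`. -/
theorem appendix_case_ii (p i j k : ℕ) [Fact p.Prime] (hp : Odd p)
    (hj1 : 1 ≤ j) (hjk : j < k) (hki : k ≤ i)
    (r : ℤ) (hpr : ¬ ((p : ℤ) ∣ r)) (β b : (ZMod (p ^ i))ˣ) :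
    (j = i - 1 → Even i → P1 p i r β b j k = -(p : ℂ) ^ (i - 1)) ∧
    (j = i - 1 → Odd i → P1 p i r β b j k =
      (legendreSym p (((β : ZMod (p ^ i)).val : ℤ) * r) : ℂ) * cP p * (p : ℂ) ^ (i - 1) *
        (Real.sqrt p : ℂ)) ∧
    (j < i - 1 → P1 p i r β b j k = 0) := by
  obtain ⟨n, rfl⟩ : ∃ n, i = n + 1 := ⟨i - 1, by omega⟩
  set π := ZMod.castHom (dvd_pow_self p n.succ_ne_zero) (ZMod p) with hπ
  have hr : (r : ZMod p) ≠ 0 := by rwa [Ne, ZMod.intCast_zmod_eq_zero_iff_dvd]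
  have ha : (r : ZMod p) * π β ≠ 0 := mul_ne_zero hr (β.isUnit.map π).ne_zero
  have hquad : (quadCharC p).IsQuadratic := (quadraticChar_isQuadratic (ZMod p)).comp _
  rw [Nat.add_sub_cancel]
  refine ⟨?_, ?_, ?_⟩
  · rintro rfl heven
    obtain rfl : k = j + 1 := by omega
    have h := gaussSum_one_left (ZMod.isPrimitive_stdAddChar p ha)
    rw [gaussSum_eq_sum_units] at h
    rw [P1_eq_sum, ← mul_neg_one, ← h]
    congr 1
    refine Finset.sum_congr rfl fun u _ => ?_
    rw [← MulChar.pow_apply_coe, hquad.pow_even heven, AddChar.mulShift_apply]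
  · rintro rfl hodd
    obtain rfl : k = j + 1 := by omega
    have h := gaussSum_mulShift_eq (quadCharC p) (ZMod.stdAddChar (N := p)) (Units.mk0 _ ha)
    rw [gaussSum_eq_sum_units, hquad.inv, gaussSum_quadCharC p hp, Units.val_mk0] at h
    have hleg : (legendreSym p (((β : ZMod (p ^ (j + 1))).val : ℤ) * r) : ℂ) =
        quadCharC p ((r : ZMod p) * π β) := by
      simp [legendreSym, hπ, mul_comm]
    rw [P1_eq_sum, hleg, mul_assoc, mul_assoc, mul_left_comm (cP p), mul_left_comm, ← h]
    congr 1
    refine Finset.sum_congr rfl fun u _ => ?_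
    rw [← MulChar.pow_apply_coe, hquad.pow_odd hodd, AddChar.mulShift_apply]
  · intro hj
    obtain ⟨e, rfl⟩ := Nat.exists_eq_add_of_lt hj
    exact P1_eq_zero p j (e + 1) k (by omega) hjk r hpr β b
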